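/- arXiv:2507.08755 — 2 statements merged into one kernel-verified Lean document; each statement's English description precedes it below -/
import Mathlib

section
/- Assume the subgroup construction with 3 ≤ k ≤ n−1, λ_1, λ_2 ∉ H, and λ_1 ≠ λ_2. Then every k columns of G_2(b,c,∞) are linearly independent; that is, C_2(b,c,∞) is an MDS code of length n+2, dimension k, and minimum Hamming distance n − k + 3. -/
open Matrix Finset

/-- The `k × (m+1)` one-column-twisted generator matrix `G_1(b,c)`:
columns `0,…,m-1` are `(a_j^s)_s`, last column is `(b^s - λ c^s)_s`. -/
def G1mat {F : Type*} [Field F] (k m : ℕ) (a : Fin m → F) (b c lam : F) :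
    Matrix (Fin k) (Fin (m + 1)) F :=
  Matrix.of fun s j =>
    if h : (j : ℕ) < m then a ⟨j, h⟩ ^ (s : ℕ)
    else b ^ (s : ℕ) - lam * c ^ (s : ℕ)

/-- The extended matrix `G_1(b,c,∞)`, with the extra column `(0,…,0,1)ᵀ`. -/
def G1matInf {F : Type*} [Field F] (k m : ℕ) (a : Fin m → F) (b c lam : F) :
    Matrix (Fin k) (Fin (m + 2)) F :=
  Matrix.of fun s j =>
    if h : (j : ℕ) < m then a ⟨j, h⟩ ^ (s : ℕ)
    else if (j : ℕ) = m then b ^ (s : ℕ) - lam * c ^ (s : ℕ)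
    else if (s : ℕ) = k - 1 then 1 else 0

/-- The `k × (m+2)` two-column-twisted generator matrix `G_2(b,c)`. -/
def G2mat {F : Type*} [Field F] (k m : ℕ) (a : Fin m → F) (b c l1 l2 : F) :
    Matrix (Fin k) (Fin (m + 2)) F :=
  Matrix.of fun s j =>
    if h : (j : ℕ) < m then a ⟨j, h⟩ ^ (s : ℕ)
    else if (j : ℕ) = m then b ^ (s : ℕ) - l1 * c ^ (s : ℕ)
    else b ^ (s : ℕ) - l2 * c ^ (s : ℕ)

/-- The extended matrix `G_2(b,c,∞)`, with the extra column `(0,…,0,1)ᵀ`. -/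
def G2matInf {F : Type*} [Field F] (k m : ℕ) (a : Fin m → F) (b c l1 l2 : F) :
    Matrix (Fin k) (Fin (m + 3)) F :=
  Matrix.of fun s j =>
    if h : (j : ℕ) < m then a ⟨j, h⟩ ^ (s : ℕ)
    else if (j : ℕ) = m then b ^ (s : ℕ) - l1 * c ^ (s : ℕ)
    else if (j : ℕ) = m + 1 then b ^ (s : ℕ) - l2 * c ^ (s : ℕ)
    else if (s : ℕ) = k - 1 then 1 else 0

/-- The code generated by a matrix: the span of its rows. -/
def rowSpan {F : Type*} [Field F] {k N : ℕ} (G : Matrix (Fin k) (Fin N) F) :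
    Submodule F (Fin N → F) :=
  Submodule.span F (Set.range fun s => G s)

/-- Every `k` columns of the `k × N` matrix `G` are linearly independent. -/
def colsIndep {F : Type*} [Field F] {k N : ℕ} (G : Matrix (Fin k) (Fin N) F) : Prop :=
  ∀ e : Fin k → Fin N, Function.Injective e → (G.submatrix id e).det ≠ 0

/-- Minimum Hamming distance (= minimum Hamming weight) of a linear code. -/
noncomputable def minDist {F : Type*} [Field F] [DecidableEq F] {N : ℕ}
    (C : Submodule F (Fin N → F)) : ℕ :=
  sInf {d | ∃ x ∈ C, x ≠ 0 ∧ hammingNorm x = d}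

/-- The Schur (componentwise) product of two linear codes. -/
def schurMul {F : Type*} [Field F] {N : ℕ} (C D : Submodule F (Fin N → F)) :
    Submodule F (Fin N → F) :=
  Submodule.span F {x | ∃ c ∈ C, ∃ d ∈ D, x = c * d}

/-- The Reed–Solomon code `RS_{k,N}(a)`. -/
def RSCode {F : Type*} [Field F] (k N : ℕ) (a : Fin N → F) : Submodule F (Fin N → F) :=
  Submodule.span F
    {x | ∃ f : Polynomial F, f.degree < (k : WithBot ℕ) ∧ x = fun j => f.eval (a j)}

/-- The extended Reed–Solomon code `RS_{k,n-1}(a,∞)` of total length `n`. -/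
def RSextCode {F : Type*} [Field F] (k n : ℕ) (a : Fin (n - 1) → F) :
    Submodule F (Fin n → F) :=
  Submodule.span F
    {x | ∃ f : Polynomial F, f.degree < (k : WithBot ℕ) ∧
      x = fun j : Fin n =>
        if h : (j : ℕ) < n - 1 then f.eval (a ⟨j, h⟩) else f.coeff (k - 1)}

/-- Equivalence of linear codes: equal up to a permutation of coordinates and
multiplication by nonzero scalars in each coordinate. -/
def codeEquiv {F : Type*} [Field F] {N : ℕ} (C D : Submodule F (Fin N → F)) : Prop :=
  ∃ π : Equiv.Perm (Fin N), ∃ v : Fin N → F, (∀ i, v i ≠ 0) ∧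
    (C : Set (Fin N → F)) =
      (fun x : Fin N → F => fun i => v i * x (π i)) '' (D : Set (Fin N → F))

/-- The dual code with respect to the standard bilinear form. -/
def dualCode {F : Type*} [Field F] {N : ℕ} (C : Submodule F (Fin N → F)) :
    Submodule F (Fin N → F) where
  carrier := {y | ∀ x ∈ C, ∑ i, x i * y i = 0}
  add_mem' := by
    intro y z hy hz x hx
    have hy' := hy x hx
    have hz' := hz x hx
    simp only [Set.mem_setOf_eq, Pi.add_apply, mul_add, Finset.sum_add_distrib, hy', hz',
      add_zero]
  zero_mem' := by intro x hx; simp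
  smul_mem' := by
    intro c y hy x hx
    have h := hy x hx
    simp only [Set.mem_setOf_eq, Pi.smul_apply, smul_eq_mul, mul_left_comm, ← Finset.mul_sum,
      h, mul_zero]

section MDS

variable {F : Type*} [Field F] {k N : ℕ} {G : Matrix (Fin k) (Fin N) F}

theorem mem_rowSpan_iff {x : Fin N → F} : x ∈ rowSpan G ↔ ∃ v, v ᵥ* G = x := by
  change x ∈ Submodule.span F (Set.range G.row) ↔ _
  rw [← range_vecMulLinear, LinearMap.mem_range]
  rfl

variable [DecidableEq F]

theorem colsIndep_of_card_zeros
    (h : ∀ v : Fin k → F, k ≤ #{j | (v ᵥ* G) j = 0} → v = 0) : colsIndep G := by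
  intro e he hdet
  obtain ⟨v, hv0, hv⟩ := Matrix.exists_vecMul_eq_zero_iff.mpr hdet
  refine hv0 (h v ?_)
  calc k = #(univ.image e) := by rw [card_image_of_injective _ he, card_univ, Fintype.card_fin]
    _ ≤ _ := card_le_card fun j hj => by
      obtain ⟨i, -, rfl⟩ := mem_image.mp hj
      exact mem_filter.mpr ⟨mem_univ _, congrFun hv i⟩

theorem colsIndep.eq_zero_of_card_zeros (hG : colsIndep G) {v : Fin k → F}
    (h : k ≤ #{j | (v ᵥ* G) j = 0}) : v = 0 := by
  obtain ⟨T, hT, hcard⟩ := exists_subset_card_eq h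
  let e := T.orderEmbOfFin hcard
  by_contra hv
  refine hG e e.injective (Matrix.exists_vecMul_eq_zero_iff.mp ⟨v, hv, funext fun i => ?_⟩)
  exact (mem_filter.mp (hT (T.orderEmbOfFin_mem hcard i))).2

theorem colsIndep.finrank_rowSpan (hG : colsIndep G) (hkN : k ≤ N) :
    Module.finrank F (rowSpan G) = k := by
  have hli : LinearIndependent F G.row := by
    refine Matrix.vecMul_injective_iff.mp
      ((injective_iff_map_eq_zero G.vecMulLinear).mpr fun v hv => ?_)
    refine hG.eq_zero_of_card_zeros ?_
    have hv' : v ᵥ* G = 0 := hv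
    simpa [hv'] using hkN
  exact (finrank_span_eq_card hli).trans (Fintype.card_fin k)

theorem card_zeros_add_hammingNorm (x : Fin N → F) : #{j | x j = 0} + hammingNorm x = N := by
  simpa [hammingNorm] using card_filter_add_card_filter_not (s := univ) (fun j => x j = 0)

theorem colsIndep.minDist_rowSpan (hG : colsIndep G) (hk : 0 < k) (hkN : k ≤ N) :
    minDist (rowSpan G) = N - k + 1 := by
  have lower : ∀ x ∈ rowSpan G, x ≠ 0 → N - k + 1 ≤ hammingNorm x := by
    intro x hx hx0
    obtain ⟨v, rfl⟩ := mem_rowSpan_iff.mp hx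
    have hzeros : #{j | (v ᵥ* G) j = 0} < k := by
      by_contra! hle
      exact hx0 (by rw [hG.eq_zero_of_card_zeros hle, Matrix.zero_vecMul])
    have := card_zeros_add_hammingNorm (v ᵥ* G)
    lia
  obtain ⟨k, rfl⟩ := Nat.exists_eq_add_of_le' hk
  let e := Fin.castLEEmb hkN
  let B := G.submatrix id e
  have hB : IsUnit B.det := (hG e e.injective).isUnit
  let v := (Pi.single 0 1 : Fin (k + 1) → F) ᵥ* B⁻¹
  have hv : ∀ i, (v ᵥ* G) (e i) = (Pi.single 0 1 : Fin (k + 1) → F) i := by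
    intro i
    change (v ᵥ* B) i = _
    rw [Matrix.vecMul_vecMul, Matrix.nonsing_inv_mul _ hB, Matrix.vecMul_one]
  have hne : v ᵥ* G ≠ 0 := fun h => by simpa [h] using hv 0
  have hzeros : k ≤ #{j | (v ᵥ* G) j = 0} := by
    calc k = #(univ.map ((Fin.succEmb k).trans e)) := by simp
      _ ≤ _ := card_le_card fun j hj => by
        obtain ⟨i, -, rfl⟩ := mem_map.mp hj
        exact mem_filter.mpr ⟨mem_univ _, by simpa using hv i.succ⟩
  have hmem : v ᵥ* G ∈ rowSpan G := mem_rowSpan_iff.mpr ⟨v, rfl⟩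
  have hweight : hammingNorm (v ᵥ* G) = N - (k + 1) + 1 := by
    have := lower _ hmem hne
    have := card_zeros_add_hammingNorm (v ᵥ* G)
    lia
  refine le_antisymm (Nat.sInf_le ⟨_, hmem, hne, hweight⟩) (le_csInf ⟨_, _, hmem, hne, rfl⟩ ?_)
  rintro _ ⟨x, hx, hx0, rfl⟩
  exact lower x hx hx0

end MDS

section Polynomial

open Polynomial

variable {F : Type*} [Field F]

/-- A polynomial with one more coefficient than known roots is determined up to a scalar, so the
ratio of its values at `b` and `c` is that of the nodal polynomial of its roots. -/
theorem Polynomial.eq_zero_of_eval_nodal_ratio {ι : Type*} {A : Finset ι} {a : ι → F}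
    (ha : Set.InjOn a A) {b c l h : F} (hc : ∀ i ∈ A, a i ≠ c) (hlh : h ≠ l)
    (hnodal : ∏ i ∈ A, (b - a i) = h * ∏ i ∈ A, (c - a i))
    {f : F[X]} (hdeg : f.degree < ((#A + 1 : ℕ) : WithBot ℕ))
    (hf : ∀ i ∈ A, f.eval (a i) = 0) (hfb : f.eval b = l * f.eval c) : f = 0 := by
  classical
  have hcA : c ∉ A.image a := by simpa using hc
  have hcard : #(insert c (A.image a)) = #A + 1 := by
    rw [card_insert_of_notMem hcA, card_image_of_injOn ha]
  have key : ∀ g : F[X], g.degree < ((#A + 1 : ℕ) : WithBot ℕ) → (∀ i ∈ A, g.eval (a i) = 0) →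
      g.eval c = 0 → g = 0 := by
    intro g hg hgA hgc
    refine eq_zero_of_degree_lt_of_eval_finset_eq_zero (insert c (A.image a)) (hcard ▸ hg) ?_
    simpa [hgc] using hgA
  let P := Lagrange.nodal A a
  have hPc : P.eval c ≠ 0 := by
    rw [Lagrange.eval_nodal, prod_ne_zero_iff]
    exact fun i hi => sub_ne_zero.mpr (hc i hi).symm
  have hPb : P.eval b = h * P.eval c := by simpa only [P, Lagrange.eval_nodal] using hnodal
  have hprop : C (f.eval c) * P - C (P.eval c) * f = 0 := by
    refine key _ (mem_degreeLT.mp (Submodule.sub_mem _ ?_ ?_)) (fun i hi => ?_) ?_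
    · rw [← smul_eq_C_mul]
      refine Submodule.smul_mem _ _ (mem_degreeLT.mpr ?_)
      rw [Lagrange.degree_nodal]
      exact_mod_cast Nat.lt_succ_self _
    · rw [← smul_eq_C_mul]
      exact Submodule.smul_mem _ _ (mem_degreeLT.mpr hdeg)
    · simp [P, Lagrange.eval_nodal_at_node hi, hf i hi]
    · simp [mul_comm]
  have hb : f.eval c * (h * P.eval c) - P.eval c * (l * f.eval c) = 0 := by
    simpa [hPb, hfb] using congrArg (eval b) hprop
  refine key f hdeg hf ?_
  have hmul : (h - l) * P.eval c * f.eval c = 0 := by linear_combination hb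
  exact (mul_eq_zero.mp hmul).resolve_left (mul_ne_zero (sub_ne_zero.mpr hlh) hPc)

end Polynomial

section Twisted

open Polynomial

variable {F : Type*} [Field F] {m k : ℕ} {a : Fin m → F} {b c l1 l2 : F} {f : F[X]}

theorem Fin.card_finset_castSucc_three (S : Finset (Fin (m + 3))) :
    #S = #{i : Fin m | i.castSucc.castSucc.castSucc ∈ S} +
      (if (Fin.last m).castSucc.castSucc ∈ S then 1 else 0) +
      (if (Fin.last (m + 1)).castSucc ∈ S then 1 else 0) +
      (if Fin.last (m + 2) ∈ S then 1 else 0) := by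
  have hS : #S = ∑ j, if j ∈ S then 1 else 0 := by simp
  rw [hS, Fin.sum_univ_castSucc, Fin.sum_univ_castSucc, Fin.sum_univ_castSucc, card_filter]

/-- A polynomial is zero if it has too many zeros among the evaluation functionals given by the
columns of `G_2(b,c,∞)`, provided no product of the ratios `(b - a i) / (c - a i)` is `l1`
or `l2`. -/
theorem Polynomial.eq_zero_of_twisted_zeros [DecidableEq F] (hk : 0 < k)
    (ha : Function.Injective a)
    (hab : ∀ i, a i ≠ b) (hac : ∀ i, a i ≠ c) (hbc : b ≠ c) (hl : l1 ≠ l2)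
    (hprod : ∀ A : Finset (Fin m), ∃ h, h ≠ l1 ∧ h ≠ l2 ∧
      ∏ i ∈ A, (b - a i) = h * ∏ i ∈ A, (c - a i))
    (hf : f.degree < k)
    (hcard : k ≤ #{i | f.eval (a i) = 0} + (if f.eval b = l1 * f.eval c then 1 else 0) +
      (if f.eval b = l2 * f.eval c then 1 else 0) + (if f.coeff (k - 1) = 0 then 1 else 0)) :
    f = 0 := by
  obtain ⟨A, hA⟩ : ∃ A : Finset (Fin m), A = ({i | f.eval (a i) = 0} : Finset (Fin m)) := ⟨_, rfl⟩
  rw [← hA] at hcard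
  have hfA : ∀ i ∈ A, f.eval (a i) = 0 := fun i hi => by simpa [hA] using hi
  obtain ⟨d, hd, hdcard⟩ : ∃ d : ℕ, f.degree < d ∧
      d ≤ #A + (if f.eval b = l1 * f.eval c then 1 else 0) +
        (if f.eval b = l2 * f.eval c then 1 else 0) := by
    by_cases h : f.coeff (k - 1) = 0
    · refine ⟨k - 1, ?_, by simp only [h, if_true] at hcard; lia⟩
      rw [degree_lt_iff_coeff_zero] at hf ⊢
      intro n hn
      obtain rfl | hlt := hn.eq_or_lt
      · exact h
      · exact hf n (by lia)
    · exact ⟨k, hf, by simpa [h] using hcard⟩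
  have hdeg : f.degree < ((#A + (if f.eval b = l1 * f.eval c then 1 else 0) +
      (if f.eval b = l2 * f.eval c then 1 else 0) : ℕ) : WithBot ℕ) :=
    hd.trans_le (by exact_mod_cast hdcard)
  obtain ⟨h, hh1, hh2, hh⟩ := hprod A
  by_cases h1 : f.eval b = l1 * f.eval c <;> by_cases h2 : f.eval b = l2 * f.eval c
  · have hfc : f.eval c = 0 := by
      have : (l1 - l2) * f.eval c = 0 := by linear_combination h2 - h1
      exact (mul_eq_zero.mp this).resolve_left (sub_ne_zero.mpr hl)
    have hfb : f.eval b = 0 := by rw [h1, hfc, mul_zero]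
    have hS : #(insert b (insert c (A.image a))) = #A + 1 + 1 := by
      rw [card_insert_of_notMem (by simpa [hbc] using fun i _ => hab i),
        card_insert_of_notMem (by simpa using fun i _ => hac i), card_image_of_injective _ ha]
    refine eq_zero_of_degree_lt_of_eval_finset_eq_zero (insert b (insert c (A.image a))) ?_ ?_
    · rw [hS]
      simpa only [if_pos h1, if_pos h2] using hdeg
    · simpa [hfb, hfc] using hfA
  · exact eq_zero_of_eval_nodal_ratio ha.injOn (fun i _ => hac i) hh1 hh
      (by simpa only [if_pos h1, if_neg h2, add_zero] using hdeg) hfA h1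
  · exact eq_zero_of_eval_nodal_ratio ha.injOn (fun i _ => hac i) hh2 hh
      (by simpa only [if_neg h1, if_pos h2, add_zero] using hdeg) hfA h2
  · refine eq_zero_of_degree_lt_of_eval_finset_eq_zero (A.image a) ?_ (by simpa using hfA)
    rw [card_image_of_injective _ ha]
    simpa only [if_neg h1, if_neg h2, add_zero] using hdeg

theorem colsIndep_G2matInf [DecidableEq F] (hk : 0 < k) (ha : Function.Injective a)
    (hab : ∀ i, a i ≠ b) (hac : ∀ i, a i ≠ c) (hbc : b ≠ c) (hl : l1 ≠ l2)
    (hprod : ∀ A : Finset (Fin m), ∃ h, h ≠ l1 ∧ h ≠ l2 ∧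
      ∏ i ∈ A, (b - a i) = h * ∏ i ∈ A, (c - a i)) :
    colsIndep (G2matInf k m a b c l1 l2) := by
  refine colsIndep_of_card_zeros fun v hv => ?_
  let f : degreeLT F k := (degreeLTEquiv F k).symm v
  have hcoeff : ∀ s : Fin k, (f : F[X]).coeff s = v s := fun s =>
    congrFun ((degreeLTEquiv F k).apply_symm_apply v) s
  have heval : ∀ x, (f : F[X]).eval x = ∑ s, v s * x ^ (s : ℕ) := fun x => by
    rw [eval_eq_sum_degreeLTEquiv f.2]
    simp [f]
  suffices hf : (f : F[X]) = 0 from funext fun s => by rw [← hcoeff, hf]; simp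
  have hcol : ∀ i : Fin m, (v ᵥ* G2matInf k m a b c l1 l2) i.castSucc.castSucc.castSucc =
      (f : F[X]).eval (a i) := fun i => by
    simp [Matrix.vecMul, dotProduct, G2matInf, heval]
  have htwist1 : (v ᵥ* G2matInf k m a b c l1 l2) (Fin.last m).castSucc.castSucc =
      (f : F[X]).eval b - l1 * (f : F[X]).eval c := by
    simp [Matrix.vecMul, dotProduct, G2matInf, heval, mul_sub, mul_sum, mul_left_comm]
  have htwist2 : (v ᵥ* G2matInf k m a b c l1 l2) (Fin.last (m + 1)).castSucc =
      (f : F[X]).eval b - l2 * (f : F[X]).eval c := by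
    simp [Matrix.vecMul, dotProduct, G2matInf, heval, mul_sub, mul_sum, mul_left_comm]
  have hinf : (v ᵥ* G2matInf k m a b c l1 l2) (Fin.last (m + 2)) =
      (f : F[X]).coeff (k - 1) := by
    have hlast : ∀ s : Fin k, (s : ℕ) = k - 1 ↔ s = ⟨k - 1, by lia⟩ := fun s => by
      rw [Fin.ext_iff]
    rw [show k - 1 = ((⟨k - 1, by lia⟩ : Fin k) : ℕ) from rfl, hcoeff]
    simp [Matrix.vecMul, dotProduct, G2matInf, hlast]
  rw [Fin.card_finset_castSucc_three] at hv
  simp only [mem_filter, mem_univ, true_and, hcol, htwist1, htwist2, hinf, sub_eq_zero] at hv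
  exact Polynomial.eq_zero_of_twisted_zeros hk ha hab hac hbc hl hprod (mem_degreeLT.mp f.2) hv

end Twisted

/-- Subgroup construction (`n = m+1`): `H ≤ Fˣ`, the `μ_i` are
pairwise distinct elements of `H \ {1}`, `b ≠ c`, `a_i = (b - μ_i c)/(1 - μ_i)`,
`λ_1, λ_2 ∉ H`, `λ_1 ≠ λ_2`. Then for `3 ≤ k ≤ n-1` every `k` columns of `G_2(b,c,∞)`
are linearly independent; that is, `C_2(b,c,∞)` is an MDS code of length `n+2`,
dimension `k`, and minimum Hamming distance `n - k + 3`. -/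
theorem C2inf_subgroup_MDS {F : Type*} [Field F] [Fintype F] [DecidableEq F] (m k : ℕ)
    (hk1 : 3 ≤ k) (hkm : k ≤ m)
    (H : Subgroup Fˣ) (μ : Fin m → Fˣ)
    (hμH : ∀ i, μ i ∈ H) (hμ1 : ∀ i, μ i ≠ 1) (hμinj : Function.Injective μ)
    (b c l1 l2 : F) (hbc : b ≠ c) (hl : l1 ≠ l2)
    (hl1 : ∀ u : Fˣ, u ∈ H → (u : F) ≠ l1) (hl2 : ∀ u : Fˣ, u ∈ H → (u : F) ≠ l2)
    (a : Fin m → F) (ha : ∀ i, a i = (b - (μ i : F) * c) / (1 - (μ i : F))) :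
    colsIndep (G2matInf k m a b c l1 l2) ∧
      Module.finrank F (rowSpan (G2matInf k m a b c l1 l2)) = k ∧
      minDist (rowSpan (G2matInf k m a b c l1 l2)) = (m + 3) - k + 1 := by
  have hμ : ∀ i, (1 - (μ i : F)) ≠ 0 := fun i =>
    sub_ne_zero.mpr fun h => hμ1 i (Units.ext h.symm)
  have hsub : b - c ≠ 0 := sub_ne_zero.mpr hbc
  have hca : ∀ i, c - a i = -(b - c) / (1 - (μ i : F)) := fun i => by
    rw [ha, eq_div_iff (hμ i), sub_mul, div_mul_cancel₀ _ (hμ i)]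
    ring
  have hba : ∀ i, b - a i = μ i * (c - a i) := fun i => by
    have := hμ i
    rw [ha]
    field_simp
    ring
  have hac : ∀ i, a i ≠ c := fun i h => by
    have hz := hca i
    rw [h, sub_self] at hz
    exact div_ne_zero (neg_ne_zero.mpr hsub) (hμ i) hz.symm
  have hab : ∀ i, a i ≠ b := fun i h => by
    have hz := hba i
    rw [h, sub_self] at hz
    exact mul_ne_zero (μ i).ne_zero (sub_ne_zero.mpr hbc.symm) hz.symm
  have hinj : Function.Injective a := fun i j h => by
    refine hμinj (Units.ext (mul_right_cancel₀ (sub_ne_zero.mpr (hac i).symm) ?_))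
    rw [← hba, h, ← hba]
  have hprod : ∀ A : Finset (Fin m), ∃ h, h ≠ l1 ∧ h ≠ l2 ∧
      ∏ i ∈ A, (b - a i) = h * ∏ i ∈ A, (c - a i) := fun A => by
    have hA : ∏ i ∈ A, μ i ∈ H := H.prod_mem fun i _ => hμH i
    refine ⟨_, hl1 _ hA, hl2 _ hA, ?_⟩
    simp only [hba, prod_mul_distrib, Units.coe_prod]
  have hG := colsIndep_G2matInf (k := k) (by lia) hinj hab hac hbc hl hprod
  exact ⟨hG, hG.finrank_rowSpan (by lia), hG.minDist_rowSpan (by lia) (by lia)⟩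
end

section
/- Assume the subgroup construction with 3 ≤ k and 2k ≤ n, λ_1, λ_2 ∉ H, λ_1 ≠ λ_2, and λ_1, λ_2 ≠ 0. Then the Schur square code C_2(b,c,∞)^2 has dimension exactly 2k over F. -/
open Matrix Finset

open Polynomial in
/-- The linear map sending `f` to its codeword in the twisted code: evaluations at the `a j`, the
two twisted values at `b, c`, and the coefficient of degree `k - 1`. -/
noncomputable def twistedEval {F : Type*} [Field F] (k m : ℕ) (a : Fin m → F) (b c l1 l2 : F) :
    F[X] →ₗ[F] (Fin (m + 3) → F) where
  toFun f j :=
    if h : (j : ℕ) < m then f.eval (a ⟨j, h⟩)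
    else if (j : ℕ) = m then f.eval b - l1 * f.eval c
    else if (j : ℕ) = m + 1 then f.eval b - l2 * f.eval c
    else f.coeff (k - 1)
  map_add' f g := by
    ext j
    simp only [Pi.add_apply, eval_add, coeff_add]
    split_ifs <;> ring
  map_smul' r f := by
    ext j
    simp only [Pi.smul_apply, smul_eq_mul, eval_smul, coeff_smul, RingHom.id_apply]
    split_ifs <;> ring

open Polynomial in
/-- The linear map sending `(h, t)` to the word whose coordinates are those of the product of the
codewords of `f` and `g` when `h = f * g` and `t = f(b) g(c) + f(c) g(b)`. -/
noncomputable def twistedSquareEval {F : Type*} [Field F] (k m : ℕ) (a : Fin m → F)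
    (b c l1 l2 : F) : F[X] × F →ₗ[F] (Fin (m + 3) → F) where
  toFun p j :=
    if h : (j : ℕ) < m then p.1.eval (a ⟨j, h⟩)
    else if (j : ℕ) = m then p.1.eval b - l1 * p.2 + l1 ^ 2 * p.1.eval c
    else if (j : ℕ) = m + 1 then p.1.eval b - l2 * p.2 + l2 ^ 2 * p.1.eval c
    else p.1.coeff (k - 1 + (k - 1))
  map_add' p q := by
    ext j
    simp only [Pi.add_apply, Prod.fst_add, Prod.snd_add, eval_add, coeff_add]
    split_ifs <;> ring
  map_smul' r p := by
    ext j
    simp only [Pi.smul_apply, Prod.smul_fst, Prod.smul_snd, smul_eq_mul, eval_smul, coeff_smul,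
      RingHom.id_apply]
    split_ifs <;> ring

section TwistedSquare

open Polynomial

variable {F : Type*} [Field F] {k m : ℕ} {a : Fin m → F} {b c l1 l2 : F}

theorem rowSpan_G2matInf :
    rowSpan (G2matInf k m a b c l1 l2)
      = (degreeLT F k).map (twistedEval k m a b c l1 l2) := by
  classical
  rw [degreeLT_eq_span_X_pow, Submodule.map_span, rowSpan]
  have row (s : Fin k) :
      twistedEval k m a b c l1 l2 (X ^ (s : ℕ)) = G2matInf k m a b c l1 l2 s := by
    ext j
    simp [twistedEval, G2matInf, coeff_X_pow, eq_comm]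
  congr 1
  ext x
  constructor
  · rintro ⟨s, rfl⟩
    exact ⟨X ^ (s : ℕ), by simpa using ⟨s, s.2, rfl⟩, row s⟩
  · rintro ⟨p, hp, rfl⟩
    simp only [coe_image, Finset.coe_range, Set.mem_image, Set.mem_Iio] at hp
    obtain ⟨s, hs, rfl⟩ := hp
    exact ⟨⟨s, hs⟩, (row ⟨s, hs⟩).symm⟩

theorem natDegree_le_pred_of_mem_degreeLT {f : F[X]} (hf : f ∈ degreeLT F k) :
    f.natDegree ≤ k - 1 := by
  rw [natDegree_le_iff_coeff_eq_zero]
  intro N hN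
  exact coeff_eq_zero_of_degree_lt ((mem_degreeLT.1 hf).trans_le (by exact_mod_cast (by omega)))

theorem twistedEval_mul {f g : F[X]} (hf : f ∈ degreeLT F k) (hg : g ∈ degreeLT F k) :
    twistedEval k m a b c l1 l2 f * twistedEval k m a b c l1 l2 g
      = twistedSquareEval k m a b c l1 l2
          (f * g, f.eval b * g.eval c + f.eval c * g.eval b) := by
  ext j
  simp only [twistedEval, twistedSquareEval, LinearMap.coe_mk, AddHom.coe_mk, Pi.mul_apply,
    eval_mul, coeff_mul_add_eq_of_natDegree_le (natDegree_le_pred_of_mem_degreeLT hf)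
      (natDegree_le_pred_of_mem_degreeLT hg)]
  split_ifs <;> ring

theorem mul_mem_degreeLT_two_mul_sub_one {f g : F[X]} (hk : 0 < k) (hf : f ∈ degreeLT F k)
    (hg : g ∈ degreeLT F k) : f * g ∈ degreeLT F (2 * k - 1) := by
  rw [mem_degreeLT]
  have h := natDegree_mul_le_of_le (natDegree_le_pred_of_mem_degreeLT hf)
    (natDegree_le_pred_of_mem_degreeLT hg)
  exact (degree_le_of_natDegree_le h).trans_lt (by exact_mod_cast (by omega))

theorem twistedEval_mul_mem_schurMul {f g : F[X]} (hf : f ∈ degreeLT F k)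
    (hg : g ∈ degreeLT F k) :
    twistedSquareEval k m a b c l1 l2 (f * g, f.eval b * g.eval c + f.eval c * g.eval b) ∈
      schurMul (rowSpan (G2matInf k m a b c l1 l2)) (rowSpan (G2matInf k m a b c l1 l2)) := by
  rw [rowSpan_G2matInf]
  exact Submodule.subset_span
    ⟨_, Submodule.mem_map_of_mem hf, _, Submodule.mem_map_of_mem hg, (twistedEval_mul hf hg).symm⟩

theorem X_pow_mem_degreeLT {s : ℕ} (hs : s < k) : (X ^ s : F[X]) ∈ degreeLT F k := by
  rw [mem_degreeLT, degree_X_pow]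
  exact_mod_cast hs

/-- The relation `1 * X² = X * X` gives the extra dimension of the Schur square. -/
theorem twistedSquareEval_inr_mem_schurMul (hk : 3 ≤ k) (hbc : b ≠ c) (t : F) :
    twistedSquareEval k m a b c l1 l2 (0, t) ∈
      schurMul (rowSpan (G2matInf k m a b c l1 l2)) (rowSpan (G2matInf k m a b c l1 l2)) := by
  have h0 := twistedEval_mul_mem_schurMul (a := a) (b := b) (c := c) (l1 := l1) (l2 := l2)
    (X_pow_mem_degreeLT (F := F) (k := k) (s := 0) (by omega))
    (X_pow_mem_degreeLT (s := 2) (by omega))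
  have h1 := twistedEval_mul_mem_schurMul (a := a) (b := b) (c := c) (l1 := l1) (l2 := l2)
    (X_pow_mem_degreeLT (F := F) (k := k) (s := 1) (by omega))
    (X_pow_mem_degreeLT (s := 1) (by omega))
  have h := Submodule.smul_mem _ (t / (b - c) ^ 2) (Submodule.sub_mem _ h0 h1)
  rw [← map_sub, ← map_smul] at h
  convert h using 2
  have hbc' : b - c ≠ 0 := sub_ne_zero.2 hbc
  ext1
  · simp [sq]
  · simp
    field_simp
    ring

theorem schurMul_rowSpan_G2matInf (hk : 3 ≤ k) (hbc : b ≠ c) :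
    schurMul (rowSpan (G2matInf k m a b c l1 l2)) (rowSpan (G2matInf k m a b c l1 l2))
      = ((degreeLT F (2 * k - 1)).prod ⊤).map (twistedSquareEval k m a b c l1 l2) := by
  classical
  apply le_antisymm
  · rw [rowSpan_G2matInf]
    refine Submodule.span_le.2 ?_
    rintro x ⟨_, ⟨f, hf, rfl⟩, _, ⟨g, hg, rfl⟩, rfl⟩
    rw [twistedEval_mul hf hg]
    exact Submodule.mem_map_of_mem
      ⟨mul_mem_degreeLT_two_mul_sub_one (by omega) hf hg, Submodule.mem_top⟩
  · rw [Submodule.map_le_iff_le_comap]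
    rintro ⟨h, t⟩ ⟨hh, -⟩
    have hinl : degreeLT F (2 * k - 1) ≤
        (schurMul (rowSpan (G2matInf k m a b c l1 l2))
          (rowSpan (G2matInf k m a b c l1 l2))).comap
            (twistedSquareEval k m a b c l1 l2 ∘ₗ LinearMap.inl F F[X] F) := by
      rw [degreeLT_eq_span_X_pow, Submodule.span_le]
      intro p hp
      simp only [coe_image, Finset.coe_range, Set.mem_image, Set.mem_Iio] at hp
      obtain ⟨i, hi, rfl⟩ := hp
      obtain ⟨r, s, hr, hs, rfl⟩ : ∃ r s, r < k ∧ s < k ∧ r + s = i :=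
        ⟨min i (k - 1), i - min i (k - 1), by omega, by omega, by omega⟩
      have h1 := twistedEval_mul_mem_schurMul (a := a) (b := b) (c := c) (l1 := l1) (l2 := l2)
        (X_pow_mem_degreeLT (F := F) hr) (X_pow_mem_degreeLT hs)
      have h2 := Submodule.sub_mem _ h1 (twistedSquareEval_inr_mem_schurMul hk hbc
        ((X ^ r : F[X]).eval b * (X ^ s : F[X]).eval c
          + (X ^ r : F[X]).eval c * (X ^ s : F[X]).eval b))
      rw [← map_sub, Prod.mk_sub_mk, sub_self, sub_zero, ← pow_add] at h2
      exact h2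
    have h3 := Submodule.add_mem _ (Submodule.mem_comap.1 (hinl hh))
      (twistedSquareEval_inr_mem_schurMul (a := a) (l1 := l1) (l2 := l2) hk hbc t)
    rw [LinearMap.comp_apply, LinearMap.inl_apply, ← map_add, Prod.mk_add_mk, add_zero,
      zero_add] at h3
    exact h3

theorem eq_zero_of_twistedSquareEval_eq_zero (hkm : 2 * k - 1 ≤ m) (hl1 : l1 ≠ 0)
    (ha : Function.Injective a) {h : F[X]} (hh : h ∈ degreeLT F (2 * k - 1)) {t : F}
    (h0 : twistedSquareEval k m a b c l1 l2 (h, t) = 0) : h = 0 ∧ t = 0 := by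
  have hzero : h = 0 := by
    refine eq_zero_of_degree_lt_of_eval_index_eq_zero Finset.univ ha.injOn ?_ ?_
    · refine (mem_degreeLT.1 hh).trans_le ?_
      rw [Finset.card_univ, Fintype.card_fin]
      exact_mod_cast hkm
    · intro i _
      simpa [twistedSquareEval] using congrFun h0 ⟨i, by omega⟩
  subst hzero
  exact ⟨rfl, by simpa [twistedSquareEval, hl1] using congrFun h0 ⟨m, by omega⟩⟩

theorem finrank_map_twistedSquareEval (hk : 0 < k) (hkm : 2 * k - 1 ≤ m) (hl1 : l1 ≠ 0)
    (ha : Function.Injective a) :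
    Module.finrank F
      (((degreeLT F (2 * k - 1)).prod ⊤).map (twistedSquareEval k m a b c l1 l2)) = 2 * k := by
  let ι : degreeLT F (2 * k - 1) × F →ₗ[F] F[X] × F :=
    (degreeLT F (2 * k - 1)).subtype.prodMap LinearMap.id
  have hι : LinearMap.range ι = (degreeLT F (2 * k - 1)).prod ⊤ := by
    rw [LinearMap.range_prodMap, Submodule.range_subtype, LinearMap.range_id]
  have hinj : Function.Injective (twistedSquareEval k m a b c l1 l2 ∘ₗ ι) := by
    rw [← LinearMap.ker_eq_bot, LinearMap.ker_eq_bot']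
    rintro ⟨⟨h, hh⟩, t⟩ h0
    obtain ⟨rfl, rfl⟩ := eq_zero_of_twistedSquareEval_eq_zero hkm hl1 ha hh h0
    rfl
  have : Module.Finite F (degreeLT F (2 * k - 1)) :=
    Module.Finite.equiv (degreeLTEquiv F (2 * k - 1)).symm
  rw [← hι, ← LinearMap.range_comp, LinearMap.finrank_range_of_inj hinj, Module.finrank_prod,
    (degreeLTEquiv F (2 * k - 1)).finrank_eq, Module.finrank_fin_fun, Module.finrank_self]
  omega

end TwistedSquare

/-- Subgroup construction (`n = m+1`), `3 ≤ k`, `2k ≤ n`,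
`λ_1, λ_2 ∉ H`, `λ_1 ≠ λ_2`, `λ_1, λ_2 ≠ 0`. Then the Schur square of `C_2(b,c,∞)` has
dimension exactly `2k`. -/
theorem C2inf_schur_square_dim {F : Type*} [Field F] [Fintype F] (m k : ℕ)
    (hk3 : 3 ≤ k) (hkn : 2 * k ≤ m + 1)
    (H : Subgroup Fˣ) (μ : Fin m → Fˣ)
    (hμH : ∀ i, μ i ∈ H) (hμ1 : ∀ i, μ i ≠ 1) (hμinj : Function.Injective μ)
    (b c l1 l2 : F) (hbc : b ≠ c) (hl : l1 ≠ l2) (hl10 : l1 ≠ 0) (hl20 : l2 ≠ 0)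
    (hl1 : ∀ u : Fˣ, u ∈ H → (u : F) ≠ l1) (hl2 : ∀ u : Fˣ, u ∈ H → (u : F) ≠ l2)
    (a : Fin m → F) (ha : ∀ i, a i = (b - (μ i : F) * c) / (1 - (μ i : F))) :
    Module.finrank F
      (schurMul (rowSpan (G2matInf k m a b c l1 l2)) (rowSpan (G2matInf k m a b c l1 l2)))
      = 2 * k := by
  have hμne (i : Fin m) : (1 : F) - μ i ≠ 0 :=
    sub_ne_zero.2 fun h => hμ1 i (Units.ext h.symm)
  have hainj : Function.Injective a := by
    intro i j hij
    rw [ha, ha, div_eq_div_iff (hμne i) (hμne j)] at hij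
    have h : (b - c) * ((μ i : F) - μ j) = 0 := by linear_combination hij
    exact hμinj (Units.ext (sub_eq_zero.1 ((mul_eq_zero.1 h).resolve_left (sub_ne_zero.2 hbc))))
  rw [schurMul_rowSpan_G2matInf hk3 hbc]
  exact finrank_map_twistedSquareEval (by omega) (by omega) hl10 hainj
end
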